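/- Let R be a commutative ring with a faithful finitely generated perfect Gabriel topology G whose perfect localisation is u : R → U (a flat injective ring epimorphism with G = {J ≤ R : JU = U}), and suppose R/J is a perfect ring for every J ∈ G. Then K := U/R is Σ-pure-split: every pure exact sequence 0 → X → T → Y → 0 with T ∈ Add(K) splits. -/

import Mathlib

universe u

/-- A Gabriel topology on a commutative ring `R`: a filter of ideals of `R`
satisfying the Gabriel axiom T4. -/
structure GabrielTopology (R : Type u) [CommRing R] : Type u where
  sets : Set (Ideal R)
  top_mem : (⊤ : Ideal R) ∈ sets
  mem_of_le : ∀ {I J : Ideal R}, I ∈ sets → I ≤ J → J ∈ sets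
  inf_mem : ∀ {I J : Ideal R}, I ∈ sets → J ∈ sets → I ⊓ J ∈ sets
  gabriel : ∀ I J : Ideal R, J ∈ sets →
    (∀ r ∈ J, Submodule.colon I (Ideal.span {r}) ∈ sets) → I ∈ sets

namespace GabrielTopology

variable {R : Type u} [CommRing R] (G : GabrielTopology R)

/-- A module `M` is `G`-torsion if the annihilator of every element belongs to `G`. -/
def IsTorsion (M : Type u) [AddCommGroup M] [Module R M] : Prop :=
  ∀ x : M, Ideal.torsionOf R M x ∈ G.sets

/-- A module `M` is `G`-torsion-free if no nonzero element is annihilated by an ideal of `G`. -/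
def IsTorsionFree (M : Type u) [AddCommGroup M] [Module R M] : Prop :=
  ∀ x : M, Ideal.torsionOf R M x ∈ G.sets → x = 0

/-- A module `M` is `G`-divisible if `JM = M` for every `J ∈ G`. -/
def IsDivisible (M : Type u) [AddCommGroup M] [Module R M] : Prop :=
  ∀ J ∈ G.sets, J • (⊤ : Submodule R M) = ⊤

/-- `G` is faithful if `R` is `G`-torsion-free. -/
def Faithful : Prop := ∀ r : R, Ideal.torsionOf R R r ∈ G.sets → r = 0

/-- `G` is finitely generated if it has a basis of finitely generated ideals. -/
def FinitelyGenerated : Prop := ∀ J ∈ G.sets, ∃ J' ∈ G.sets, J' ≤ J ∧ J'.FG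

end GabrielTopology

/-- `Ext¹_R(M, N) = 0`, expressed by the standard characterisation:
every short exact sequence `0 → N → E → M → 0` splits. -/
def Ext1Vanish (R : Type u) [CommRing R] (M N : Type u) [AddCommGroup M] [Module R M]
    [AddCommGroup N] [Module R N] : Prop :=
  ∀ (E : Type u) [AddCommGroup E] [Module R E] (i : N →ₗ[R] E) (p : E →ₗ[R] M),
    Function.Injective i → Function.Surjective p → LinearMap.range i = LinearMap.ker p →
      ∃ s : M →ₗ[R] E, p ∘ₗ s = LinearMap.id

/-- `M` has projective dimension at most 1: the kernel of a free cover is projective. -/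
def ProjDimLE1 (R : Type u) [CommRing R] (M : Type u) [AddCommGroup M] [Module R M] : Prop :=
  ∃ (ι : Type u) (p : (ι →₀ R) →ₗ[R] M),
    Function.Surjective p ∧ Module.Projective R ↥(LinearMap.ker p)

/-- `M ∈ Add(T)`: `M` is a direct summand of a direct sum of copies of `T`. -/
def InAdd (R : Type u) [CommRing R] (T M : Type u) [AddCommGroup T] [Module R T]
    [AddCommGroup M] [Module R M] : Prop :=
  ∃ (ι : Type u) (s : M →ₗ[R] (ι →₀ T)) (r : (ι →₀ T) →ₗ[R] M), r ∘ₗ s = LinearMap.id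

/-- `T` is a 1-tilting module: (T1) `p.dim T ≤ 1`, (T2) `Ext¹(T, T^(κ)) = 0` for all κ,
(T3) there is an exact sequence `0 → R → T₀ → T₁ → 0` with `T₀, T₁ ∈ Add(T)`. -/
def Is1Tilting (R : Type u) [CommRing R] (T : Type u) [AddCommGroup T] [Module R T] : Prop :=
  ProjDimLE1 R T ∧
  (∀ ι : Type u, Ext1Vanish R T (ι →₀ T)) ∧
  ∃ (T0 T1 : ModuleCat.{u} R) (i : R →ₗ[R] ↥T0) (p : ↥T0 →ₗ[R] ↥T1),
    InAdd R T ↥T0 ∧ InAdd R T ↥T1 ∧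
    Function.Injective i ∧ Function.Surjective p ∧ LinearMap.range i = LinearMap.ker p

namespace GabrielTopology

variable {R : Type u} [CommRing R] (G : GabrielTopology R)

/-- `(𝒜, 𝒟_G)` is a 1-tilting cotorsion pair with associated Gabriel topology `G`:
`G` is a faithful finitely generated Gabriel topology and the class of `G`-divisible
modules is the tilting class of a 1-tilting module. -/
def IsTiltingTopology : Prop :=
  G.Faithful ∧ G.FinitelyGenerated ∧
  ∃ T : ModuleCat.{u} R, Is1Tilting R ↥T ∧
    ∀ (M : Type u) [AddCommGroup M] [Module R M], (Ext1Vanish R ↥T M ↔ G.IsDivisible M)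

/-- Membership in the left-hand class `𝒜 = ᗮ(𝒟_G)` of the 1-tilting cotorsion pair. -/
def MemA (M : Type u) [AddCommGroup M] [Module R M] : Prop :=
  ∀ (D : Type u) [AddCommGroup D] [Module R D], G.IsDivisible D → Ext1Vanish R M D

/-- The class `𝒜` is covering: every module has an `𝒜`-cover. -/
def IsACovering : Prop :=
  ∀ (M : Type u) [AddCommGroup M] [Module R M],
    ∃ (C : ModuleCat.{u} R) (φ : ↥C →ₗ[R] M),
      G.MemA ↥C ∧
      (∀ (C' : Type u) [AddCommGroup C'] [Module R C'], G.MemA C' →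
        ∀ f : C' →ₗ[R] M, ∃ g : C' →ₗ[R] ↥C, φ ∘ₗ g = f) ∧
      (∀ e : ↥C →ₗ[R] ↥C, φ ∘ₗ e = φ → Function.Bijective e)

/-- The class `𝒜` is closed under direct limits. -/
def AClosedUnderDirectLimits : Prop :=
  ∀ (ι : Type u) [Preorder ι] [IsDirected ι (· ≤ ·)] [Nonempty ι] [DecidableEq ι]
    (M : ι → Type u) [∀ i, AddCommGroup (M i)] [∀ i, Module R (M i)]
    (f : ∀ i j, i ≤ j → M i →ₗ[R] M j) [DirectedSystem M fun i j h => f i j h],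
    (∀ i, G.MemA (M i)) → G.MemA (Module.DirectLimit M f)

/-- `Q`, via `algebraMap R Q`, is the ring of quotients `R_G` of `R` with respect to `G`:
`Q` is `G`-torsion-free and `G`-injective (i.e. `G`-closed) and the kernel and cokernel
of `R → Q` are `G`-torsion. -/
structure IsRingOfQuotients (Q : Type u) [CommRing Q] [Algebra R Q] : Prop where
  torsionFree : ∀ q : Q, Ideal.torsionOf R Q q ∈ G.sets → q = 0
  gInjective : ∀ J ∈ G.sets, ∀ f : ↥J →ₗ[R] Q, ∃ q : Q, ∀ j : ↥J, f j = (j : R) • q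
  ker_torsion : ∀ r : R, algebraMap R Q r = 0 → Ideal.torsionOf R R r ∈ G.sets
  coker_torsion : ∀ q : Q, ∃ J ∈ G.sets, ∀ x ∈ J, ∃ r : R, x • q = algebraMap R Q r

/-- `G` is a perfect Gabriel topology, realised by the perfect localisation `Q`:
`R → Q` is a flat ring epimorphism and `G = {J ∣ JQ = Q}`. -/
def IsPerfectLocalization (Q : Type u) [CommRing Q] [Algebra R Q] : Prop :=
  Module.Flat R Q ∧
  (∀ (S : Type u) [CommRing S] (f g : Q →+* S),
    f.comp (algebraMap R Q) = g.comp (algebraMap R Q) → f = g) ∧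
  (∀ J : Ideal R, J ∈ G.sets ↔ J • (⊤ : Submodule R Q) = ⊤)

end GabrielTopology

/-- A commutative ring is perfect iff every flat module is projective. -/
def IsPerfectRing (S : Type u) [CommRing S] : Prop :=
  ∀ (M : Type u) [AddCommGroup M] [Module S M], Module.Flat S M → Module.Projective S M

/-- `X` is Σ-pure-split: every pure embedding `A ⊆ B` with `B ∈ Add(X)` splits. -/
def SigmaPureSplit (R : Type u) [CommRing R] (X : Type u) [AddCommGroup X] [Module R X] : Prop :=
  ∀ (A B : Type u) [AddCommGroup A] [Module R A] [AddCommGroup B] [Module R B] (i : A →ₗ[R] B),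
    Function.Injective i →
    (∀ (M : Type u) [AddCommGroup M] [Module R M], Function.Injective (LinearMap.rTensor M i)) →
    InAdd R X B → ∃ r : B →ₗ[R] A, r ∘ₗ i = LinearMap.id

/-- A concrete model of `Ext¹_R(M, N)`, computed from the canonical free presentation
`0 → S → (M →₀ R) → M → 0` of `M` as `coker (Hom((M →₀ R), N) → Hom(S, N))`. -/
abbrev ext1 (R : Type u) [CommRing R] (M N : Type u) [AddCommGroup M] [Module R M]
    [AddCommGroup N] [Module R N] : Type u :=
  (↥(LinearMap.ker (Finsupp.linearCombination R (id : M → M))) →ₗ[R] N) ⧸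
    LinearMap.range
      (LinearMap.lcomp R N (LinearMap.ker (Finsupp.linearCombination R (id : M → M))).subtype)

/-- A concrete model of `Tor₁^R(M, N)`, computed from the canonical free presentation
`0 → S → (M →₀ R) → M → 0` of `M` as `ker (S ⊗ N → (M →₀ R) ⊗ N)`. -/
abbrev tor1 (R : Type u) [CommRing R] (M N : Type u) [AddCommGroup M] [Module R M]
    [AddCommGroup N] [Module R N] : Type u :=
  ↥(LinearMap.ker
    (LinearMap.rTensor N (LinearMap.ker (Finsupp.linearCombination R (id : M → M))).subtype))

/-- The cokernel `U/R` of a ring map `R → U`. -/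
abbrev cokerAlg (R U : Type u) [CommRing R] [CommRing U] [Algebra R U] : Type u :=
  U ⧸ LinearMap.range (Algebra.linearMap R U)

/-- A linear topology on a commutative ring `R`, given by its filter of open ideals. -/
structure LinearTopologyOn (R : Type u) [CommRing R] : Type u where
  sets : Set (Ideal R)
  top_mem : (⊤ : Ideal R) ∈ sets
  mem_of_le : ∀ {I J : Ideal R}, I ∈ sets → I ≤ J → J ∈ sets
  inf_mem : ∀ {I J : Ideal R}, I ∈ sets → J ∈ sets → I ⊓ J ∈ sets

/-- An `R`-module `M` is `H`-discrete if the annihilator of every element is open. -/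
def LinearTopologyOn.IsDiscrete {R : Type u} [CommRing R] (H : LinearTopologyOn R)
    (M : Type u) [AddCommGroup M] [Module R M] : Prop :=
  ∀ x : M, Ideal.torsionOf R M x ∈ H.sets

/-- `R` is `H`-h-local: every open ideal is contained in only finitely many maximal ideals,
and every open prime ideal is contained in only one maximal ideal. -/
def LinearTopologyOn.IsHLocal {R : Type u} [CommRing R] (H : LinearTopologyOn R) : Prop :=
  (∀ J ∈ H.sets, {m : Ideal R | m.IsMaximal ∧ J ≤ m}.Finite) ∧
  (∀ p ∈ H.sets, p.IsPrime →
    ∀ m n : Ideal R, m.IsMaximal → n.IsMaximal → p ≤ m → p ≤ n → m = n)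

/-- Over `S`, `M` admits a resolution of length `n` by finitely generated projectives. -/
def FGProjDimLE (S : Type u) [CommRing S] :
    ℕ → ∀ (M : Type u) [AddCommGroup M] [Module S M], Prop
  | 0, M, iA, iM =>
      letI := iA; letI := iM
      Module.Finite S M ∧ Module.Projective S M
  | n + 1, M, iA, iM =>
      letI := iA; letI := iM
      ∃ (k : ℕ) (f : (Fin k → S) →ₗ[S] M),
        Function.Surjective f ∧ FGProjDimLE S n ↥(LinearMap.ker f)
open TensorProduct in
/-- A finite system of linear equations with constants in a pure submodule that is solvable
in the ambient module is solvable in the submodule. -/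
theorem exists_solution_of_pure {R : Type u} [CommRing R] {A B : Type u}
    [AddCommGroup A] [Module R A] [AddCommGroup B] [Module R B] (i : A →ₗ[R] B)
    (hi : ∀ (M : Type u) [AddCommGroup M] [Module R M],
      Function.Injective (LinearMap.rTensor M i))
    {m n : ℕ} (r : Fin m → Fin n → R) (x : Fin m → A) (w : Fin n → B)
    (h : ∀ a, i (x a) = ∑ b, r a b • w b) :
    ∃ w' : Fin n → A, ∀ a, x a = ∑ b, r a b • w' b := by
  set N : Submodule R (Fin m → R) := Submodule.span R (Set.range fun b a => r a b)
  let e : Fin m → ((Fin m → R) ⧸ N) := fun a => N.mkQ (Pi.single a 1)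
  have hcomb (c : Fin m → R) : ∑ a, c a • e a = N.mkQ c := by
    simp only [e, ← map_smul, ← map_sum]
    congr 1
    ext k
    simp [Finset.sum_apply, Pi.single_apply]
  have hspan : Submodule.span R (Set.range e) = ⊤ := by
    rw [eq_top_iff]
    rintro y -
    obtain ⟨c, rfl⟩ := N.mkQ_surjective y
    rw [← hcomb]
    exact sum_mem fun a _ => Submodule.smul_mem _ _ (Submodule.subset_span ⟨a, rfl⟩)
  have hB : ∑ a, e a ⊗ₜ[R] i (x a) = 0 := by
    simp only [h, tmul_sum, tmul_smul]
    rw [Finset.sum_comm]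
    refine Finset.sum_eq_zero fun b _ => ?_
    simp only [← tmul_smul, ← smul_tmul, ← sum_tmul]
    rw [hcomb fun a => r a b, Submodule.mkQ_apply,
      (Submodule.Quotient.mk_eq_zero N).2 (Submodule.subset_span ⟨b, rfl⟩), zero_tmul]
  have hA : ∑ a, e a ⊗ₜ[R] x a = 0 := by
    apply (TensorProduct.comm R _ _).injective
    apply hi
    apply (TensorProduct.comm R _ _).symm.injective
    simpa using hB
  obtain ⟨k, s, y, hy, hs⟩ := vanishesTrivially_of_sum_tmul_eq_zero R hspan hA
  have hmem (c : Fin k) : ∃ t : Fin n → R, ∑ b, t b • (fun a => r a b) = fun a => s a c := by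
    have := hs c
    rw [hcomb fun a => s a c, Submodule.mkQ_apply, Submodule.Quotient.mk_eq_zero] at this
    exact (Submodule.mem_span_range_iff_exists_fun R).1 this
  choose t ht using hmem
  refine ⟨fun b => ∑ c, t c b • y c, fun a => ?_⟩
  rw [hy a]
  simp only [Finset.smul_sum, smul_smul]
  rw [Finset.sum_comm]
  refine Finset.sum_congr rfl fun c _ => ?_
  rw [← Finset.sum_smul, ← congrFun (ht c) a]
  simp [Finset.sum_apply, mul_comm]

/-- If `0 → E → V → T → 0` is exact with `E` and `V` flat, then the preimage in `V` of a pure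
submodule of `T` is flat. -/
theorem flat_comap_range_of_pure {R : Type u} [CommRing R] {A V T E : Type u}
    [AddCommGroup A] [Module R A] [AddCommGroup V] [Module R V] [AddCommGroup T] [Module R T]
    [AddCommGroup E] [Module R E] [Module.Flat R V] [Module.Flat R E]
    (i : A →ₗ[R] T)
    (hi : ∀ (M : Type u) [AddCommGroup M] [Module R M],
      Function.Injective (LinearMap.rTensor M i))
    (j : E →ₗ[R] V) (q : V →ₗ[R] T) (hj : Function.Injective j) (hq : Function.Surjective q)
    (hjq : LinearMap.range j = LinearMap.ker q) :
    Module.Flat R ((LinearMap.range i).comap q) := by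
  refine Module.Flat.of_forall_isTrivialRelation fun {l f x} hfx => ?_
  have hV : ∑ a, f a • (x a : V) = 0 := by
    simpa using congrArg Subtype.val hfx
  obtain ⟨k, r, y, hy, hr⟩ := Module.Flat.isTrivialRelation_of_sum_smul_eq_zero hV
  choose z hz using fun a => (x a).2
  obtain ⟨w, hw⟩ := exists_solution_of_pure i hi r z (fun b => q (y b)) fun a => by
    rw [hz a, show (x a : V) = _ from hy a]; simp
  choose y' hy' using fun b => hq (i (w b))
  have hg (a : Fin l) : ∃ g, j g = x a - ∑ b, r a b • y' b := by
    rw [← LinearMap.mem_range, hjq, LinearMap.mem_ker, map_sub, ← hz a, hw a]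
    simp [hy']
  choose g hg using hg
  have hE : ∑ a, f a • g a = 0 := by
    apply hj
    simp only [map_sum, map_smul, hg, smul_sub, Finset.sum_sub_distrib, hV, map_zero, zero_sub,
      neg_eq_zero, Finset.smul_sum, smul_smul]
    rw [Finset.sum_comm]
    simp [← Finset.sum_smul, hr]
  obtain ⟨k', s, e, he, hs⟩ := Module.Flat.isTrivialRelation_of_sum_smul_eq_zero hE
  rw [Module.isTrivialRelation_iff_vanishesTrivially]
  refine TensorProduct.VanishesTrivially.of_fintype (κ := Fin k ⊕ Fin k')
    (fun a => Sum.elim (r a) (s a))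
    (Sum.elim (fun b => ⟨y' b, w b, (hy' b).symm⟩)
      (fun c => ⟨j (e c), 0, ?_⟩)) ?_ ?_
  · rw [map_zero, eq_comm, ← LinearMap.mem_ker, ← hjq]
    exact ⟨_, rfl⟩
  · intro a
    apply Subtype.ext
    have := hg a
    rw [he a, map_sum, eq_sub_iff_add_eq] at this
    simp [← this, add_comm]
  · rintro (b | c)
    · simpa [mul_comm] using hr b
    · simpa [mul_comm] using hs c

open TensorProduct in
/-- Over a ring with perfect quotient `R ⧸ I`, flat modules lift against surjections between
modules killed by `I`. -/
theorem exists_lift_of_flat {R : Type u} [CommRing R] {I : Ideal R} (hI : IsPerfectRing (R ⧸ I))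
    {F A C : Type u} [AddCommGroup F] [Module R F] [AddCommGroup A] [Module R A]
    [AddCommGroup C] [Module R C] [Module.Flat R F] (hA : ∀ r ∈ I, ∀ a : A, r • a = 0)
    (g : A →ₗ[R] C) (hg : Function.Surjective g) (h : F →ₗ[R] C) :
    ∃ h' : F →ₗ[R] A, g ∘ₗ h' = h := by
  have tA : Module.IsTorsionBySet R A I := fun a r => hA r r.2 a
  have tC : Module.IsTorsionBySet R C I := fun c r => by
    obtain ⟨a, rfl⟩ := hg c
    rw [← map_smul, tA, map_zero]
  let := tA.module
  let := tC.module
  have : IsScalarTower R (R ⧸ I) A := tA.isScalarTower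
  have : IsScalarTower R (R ⧸ I) C := tC.isScalarTower
  have := hI ((R ⧸ I) ⊗[R] F) inferInstance
  obtain ⟨k, hk⟩ := Module.projective_lifting_property
    (g.extendScalarsOfSurjective (S := R ⧸ I) Ideal.Quotient.mk_surjective)
    (h.liftBaseChange (R ⧸ I)) hg
  refine ⟨(k.restrictScalars R) ∘ₗ TensorProduct.mk R (R ⧸ I) F 1, ?_⟩
  ext f
  simpa using LinearMap.congr_fun hk (1 ⊗ₜ f)

/-- In a perfect ring every submonoid contains an element divisible by all its elements. -/
theorem exists_mem_forall_dvd_of_isPerfectRing {S : Type u} [CommRing S] (hS : IsPerfectRing S)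
    (M : Submonoid S) : ∃ d ∈ M, ∀ n ∈ M, n ∣ d := by
  have := hS (Localization M) (IsLocalization.flat _ M)
  obtain ⟨s, hs⟩ := Module.projective_def.1 ‹_›
  set c := s (1 : Localization M)
  have h1 : c.sum (fun p a => a • p) = 1 := by
    simpa [Finsupp.linearCombination_apply] using hs 1
  have hdiv (p) (n) (hn : n ∈ M) : n ∣ c p := by
    refine ⟨s (IsLocalization.mk' _ 1 ⟨n, hn⟩) p, ?_⟩
    have : n • IsLocalization.mk' (Localization M) (1 : S) ⟨n, hn⟩ = 1 := by
      rw [Algebra.smul_def, IsLocalization.mul_mk'_eq_mk'_of_mul]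
      simp
    rw [← smul_eq_mul, ← Finsupp.smul_apply, ← map_smul, this]
  obtain ⟨b, hb⟩ := IsLocalization.exist_integer_multiples_of_finset M c.support
  choose t ht using hb
  have key : algebraMap S (Localization M) (b : S) =
      algebraMap S _ (∑ p ∈ c.support.attach, c p * t p.1 p.2) := by
    rw [map_sum]
    simp only [map_mul, ht]
    calc algebraMap S (Localization M) (b : S) = (b : S) • c.sum (fun p a => a • p) := by
          rw [h1, Algebra.smul_def, mul_one]
      _ = _ := by
          rw [Finsupp.sum, Finset.smul_sum, ← Finset.sum_attach]
          refine Finset.sum_congr rfl fun p _ => ?_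
          simp only [Algebra.smul_def]
          ring
  obtain ⟨m, hm⟩ := (IsLocalization.eq_iff_exists M _).1 key
  refine ⟨m * b, mul_mem m.2 b.2, fun n hn => ?_⟩
  rw [hm]
  exact Dvd.dvd.mul_left (Finset.dvd_sum fun p _ => Dvd.dvd.mul_right (hdiv _ _ hn) _) _

/-- The map `E ⧸ IE → F ⧸ IF` induced by a linear map `E → F`. -/
def mapQuotSMulTop {R : Type u} [CommRing R] {E F : Type u} [AddCommGroup E] [Module R E]
    [AddCommGroup F] [Module R F] (j : E →ₗ[R] F) (I : Ideal R) :
    (E ⧸ (I • ⊤ : Submodule R E)) →ₗ[R] (F ⧸ (I • ⊤ : Submodule R F)) :=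
  Submodule.mapQ _ _ j <| by
    rw [← Submodule.map_le_iff_le_comap, Submodule.map_smul'']
    exact Submodule.smul_mono le_rfl le_top

/-- A partial splitting `F → E ⧸ I'E` of `E → F` lifts to one modulo a smaller ideal `I` such that
`R ⧸ I` is perfect. -/
theorem exists_lift_partial_splitting {R : Type u} [CommRing R] {E F : Type u} [AddCommGroup E]
    [Module R E] [AddCommGroup F] [Module R F] [Module.Flat R F] (j : E →ₗ[R] F)
    {I I' : Ideal R} (hle : I ≤ I') (hI : IsPerfectRing (R ⧸ I))
    (hdiv : LinearMap.range j ⊔ I • ⊤ = ⊤)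
    (t' : F →ₗ[R] E ⧸ (I' • ⊤ : Submodule R E))
    (ht' : mapQuotSMulTop j I' ∘ₗ t' = Submodule.mkQ _) :
    ∃ t : F →ₗ[R] E ⧸ (I • ⊤ : Submodule R E), mapQuotSMulTop j I ∘ₗ t = Submodule.mkQ _ ∧
      Submodule.factor (Submodule.smul_mono_left hle) ∘ₗ t = t' := by
  let g := (mapQuotSMulTop j I).prod
    (Submodule.factor (Submodule.smul_mono_left hle : (I • ⊤ : Submodule R E) ≤ I' • ⊤))
  let h := (Submodule.mkQ (I • ⊤ : Submodule R F)).prod t'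
  have hgh (f : F) : h f ∈ LinearMap.range g := by
    obtain ⟨c, hc⟩ := Submodule.mkQ_surjective _ (t' f)
    have hcf : j c - f ∈ (I' • ⊤ : Submodule R F) := by
      have := LinearMap.congr_fun ht' f
      rw [LinearMap.comp_apply, ← hc] at this
      exact (Submodule.Quotient.eq _).1 this
    have hle' : (I' • ⊤ : Submodule R F) ≤ Submodule.map j (I' • ⊤) ⊔ I • ⊤ := by
      rw [Submodule.map_smul'', Submodule.map_top, ← hdiv, Submodule.smul_sup]
      refine sup_le_sup_left ?_ _
      rw [hdiv]
      exact Submodule.smul_le_right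
    obtain ⟨_, ⟨a, ha, rfl⟩, b, hb, hab⟩ := Submodule.mem_sup.1 (hle' hcf)
    refine ⟨Submodule.mkQ _ (c - a), Prod.ext ?_ ?_⟩
    · refine (Submodule.Quotient.eq _).2 ?_
      rw [map_sub, show j c - j a - f = b by rw [sub_right_comm, ← hab]; abel]
      exact hb
    · change Submodule.mkQ _ (c - a) = t' f
      rw [map_sub, hc, sub_eq_self]
      exact (Submodule.Quotient.mk_eq_zero _).2 ha
  obtain ⟨t, ht⟩ := exists_lift_of_flat hI
    (fun r hr x => by
      obtain ⟨c, rfl⟩ := Submodule.mkQ_surjective _ x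
      rw [← map_smul]
      exact (Submodule.Quotient.mk_eq_zero _).2 (Submodule.smul_mem_smul hr trivial))
    g.rangeRestrict g.surjective_rangeRestrict (h.codRestrict _ hgh)
  have ht₂ (f : F) : g (t f) = h f := congrArg Subtype.val (LinearMap.congr_fun ht f)
  exact ⟨t, LinearMap.ext fun f => congrArg Prod.fst (ht₂ f),
    LinearMap.ext fun f => congrArg Prod.snd (ht₂ f)⟩

/-- If `F = j(E) + JⁿF` and `R ⧸ Jⁿ` is perfect for all `n`, a flat module `F` admits a compatible
system of partial splittings `F → E ⧸ JⁿE` of `j : E → F`. -/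
theorem exists_compatible_partial_splittings {R : Type u} [CommRing R] {E F : Type u}
    [AddCommGroup E] [Module R E] [AddCommGroup F] [Module R F] [Module.Flat R F]
    (j : E →ₗ[R] F) (J : Ideal R) (hJ : ∀ n, IsPerfectRing (R ⧸ J ^ n))
    (hdiv : ∀ n, LinearMap.range j ⊔ J ^ n • ⊤ = ⊤) :
    ∃ t : ∀ n, F →ₗ[R] E ⧸ (J ^ n • ⊤ : Submodule R E),
      (∀ n, mapQuotSMulTop j (J ^ n) ∘ₗ t n = Submodule.mkQ _) ∧
      ∀ n, Submodule.factor (Submodule.smul_mono_left (Ideal.pow_le_pow_right n.le_succ)) ∘ₗ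
        t (n + 1) = t n := by
  have step (n : ℕ) (t' : {t' : F →ₗ[R] E ⧸ (J ^ n • ⊤ : Submodule R E) //
      mapQuotSMulTop j (J ^ n) ∘ₗ t' = Submodule.mkQ _}) :=
    exists_lift_partial_splitting j (Ideal.pow_le_pow_right n.le_succ) (hJ (n + 1))
      (hdiv (n + 1)) t'.1 t'.2
  let t : ∀ n, {t' : F →ₗ[R] E ⧸ (J ^ n • ⊤ : Submodule R E) //
      mapQuotSMulTop j (J ^ n) ∘ₗ t' = Submodule.mkQ _} := fun n =>
    Nat.rec ⟨0, by
      ext f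
      refine (Submodule.Quotient.eq _).2 ?_
      simp⟩ (fun n t' => ⟨(step n t').choose, (step n t').choose_spec.1⟩) n
  exact ⟨fun n => (t n).1, fun n => (t n).2, fun n => (step n (t n)).choose_spec.2⟩

/-- Local solution of the lifting problem: on a submodule `L` of `K` whose elements are killed by
powers of `J`, the pairing `α : K × F → T'` lifts through `p : T → T'`, provided that it does so on
the image of `E` in `F`. -/
theorem exists_pairing_lift_of_pow {R : Type u} [CommRing R] {E F K T T' : Type u}
    [AddCommGroup E] [Module R E] [AddCommGroup F] [Module R F] [Module.Flat R F]
    [AddCommGroup K] [Module R K] [AddCommGroup T] [Module R T] [AddCommGroup T'] [Module R T']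
    (j : E →ₗ[R] F) (J : Ideal R) (hJ : ∀ n, IsPerfectRing (R ⧸ J ^ n))
    (hdiv : ∀ n, LinearMap.range j ⊔ J ^ n • ⊤ = ⊤)
    (act : E →ₗ[R] K →ₗ[R] T) (p : T →ₗ[R] T') (α : K →ₗ[R] F →ₗ[R] T')
    (hα : ∀ c k, p (act c k) = α k (j c))
    (L : Submodule R K) (hL : ∀ k ∈ L, ∃ n, ∀ r ∈ J ^ n, r • k = 0) :
    ∃ b : L →ₗ[R] F →ₗ[R] T, ∀ k f, p (b k f) = α k f := by
  obtain ⟨t, ht, htc⟩ := exists_compatible_partial_splittings j J hJ hdiv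
  have act_zero {n : ℕ} {k : K} (hk : ∀ r ∈ J ^ n, r • k = 0) {c : E}
      (hc : c ∈ (J ^ n • ⊤ : Submodule R E)) : act c k = 0 := by
    induction hc using Submodule.smul_induction_on' with
    | smul r hr c _ => rw [map_smul, LinearMap.smul_apply, ← map_smul, hk r hr, map_zero]
    | add x _ y _ hx hy => rw [map_add, LinearMap.add_apply, hx, hy, add_zero]
  have α_zero {n : ℕ} {k : K} (hk : ∀ r ∈ J ^ n, r • k = 0) {f : F}
      (hf : f ∈ (J ^ n • ⊤ : Submodule R F)) : α k f = 0 := by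
    induction hf using Submodule.smul_induction_on' with
    | smul r hr c _ => rw [map_smul, ← LinearMap.smul_apply, ← map_smul, hk r hr, map_zero,
        LinearMap.zero_apply]
    | add x _ y _ hx hy => rw [map_add, hx, hy, add_zero]
  have desc {m n : ℕ} (hmn : m ≤ n) {f : F} {c : E} (hc : Submodule.mkQ _ c = t n f) :
      Submodule.mkQ _ c = t m f := by
    induction n, hmn using Nat.le_induction with
    | base => exact hc
    | succ n _ ih =>
      apply ih
      rw [← htc, LinearMap.comp_apply, ← hc]
      rfl
  choose N hN using fun k : L => hL k k.2
  choose c hc using fun n f => Submodule.mkQ_surjective _ (t n f)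
  have hb {k : L} {n : ℕ} (hk : ∀ r ∈ J ^ n, r • (k : K) = 0) {f : F} {c' : E}
      (hc' : Submodule.mkQ _ c' = t n f) : act (c (N k) f) k = act c' k := by
    rw [← sub_eq_zero, ← LinearMap.sub_apply, ← map_sub]
    have hmin : Submodule.mkQ (J ^ min (N k) n • ⊤ : Submodule R E) (c (N k) f) =
        Submodule.mkQ _ c' :=
      (desc (min_le_left _ _) (hc _ _)).trans (desc (min_le_right _ _) hc').symm
    refine act_zero (n := min (N k) n) ?_ ((Submodule.Quotient.eq _).1 hmin)
    rcases min_choice (N k) n with h | h <;> rw [h]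
    · exact hN k
    · exact hk
  refine ⟨LinearMap.mk₂ R (fun k f => act (c (N k) f) k) ?_ ?_ ?_ ?_, ?_⟩
  · intro k k' f
    set n := max (N k) (N k')
    have h₁ : ∀ r ∈ J ^ n, r • (k : K) = 0 := fun r hr =>
      hN k r (Ideal.pow_le_pow_right (le_max_left _ _) hr)
    have h₂ : ∀ r ∈ J ^ n, r • (k' : K) = 0 := fun r hr =>
      hN k' r (Ideal.pow_le_pow_right (le_max_right _ _) hr)
    have h₃ : ∀ r ∈ J ^ n, r • ((k + k' : L) : K) = 0 := fun r hr => by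
      rw [Submodule.coe_add, smul_add, h₁ r hr, h₂ r hr, add_zero]
    rw [hb h₁ (hc n f), hb h₂ (hc n f), hb h₃ (hc n f), Submodule.coe_add, map_add]
  · intro r k f
    have h : ∀ s ∈ J ^ N k, s • ((r • k : L) : K) = 0 := fun s hs => by
      rw [Submodule.coe_smul, smul_comm, hN k s hs, smul_zero]
    rw [hb h (hc _ f), Submodule.coe_smul, map_smul]
  · intro k f f'
    rw [hb (hN k) (c' := c (N k) f + c (N k) f') (by rw [map_add, map_add, hc, hc]), map_add,
      LinearMap.add_apply]
  · intro r k f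
    rw [hb (hN k) (c' := r • c (N k) f) (by rw [map_smul, map_smul, hc]), map_smul,
      LinearMap.smul_apply]
  · intro k f
    rw [LinearMap.mk₂_apply, hα, ← sub_eq_zero, ← map_sub]
    refine α_zero (hN k) ?_
    have := LinearMap.congr_fun (ht (N k)) f
    rw [LinearMap.comp_apply, ← hc] at this
    exact (Submodule.Quotient.eq _).1 this

/-- The submodule of elements on which every `n ∉ 𝔪` acts invertibly. -/
def primaryComponent {R : Type u} [CommRing R] (K : Type u) [AddCommGroup K] [Module R K]
    (𝔪 : MaximalSpectrum R) : Submodule R K where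
  carrier := {k | ∀ n ∉ 𝔪.asIdeal, ∃ r : R, r • n • k = k}
  zero_mem' n _ := ⟨0, by simp⟩
  add_mem' {x y} hx hy n hn := by
    obtain ⟨r, hr⟩ := hx n hn
    obtain ⟨s, hs⟩ := hy n hn
    refine ⟨r + s - r * s * n, ?_⟩
    have h₁ : (r + s - r * s * n) • n • x = x := by
      linear_combination (norm := module) (1 - s * n) • hr
    have h₂ : (r + s - r * s * n) • n • y = y := by
      linear_combination (norm := module) (1 - r * n) • hs
    rw [smul_add, smul_add, h₁, h₂]
  smul_mem' c x hx n hn := by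
    obtain ⟨r, hr⟩ := hx n hn
    exact ⟨r, by rw [smul_comm n, smul_comm r, hr]⟩

/-- A module whose elements have perfect `R ⧸ Ann(k)` is the direct sum of its primary
components. -/
theorem isInternal_primaryComponent {R : Type u} [CommRing R] [DecidableEq (MaximalSpectrum R)]
    {K : Type u} [AddCommGroup K]
    [Module R K] (hK : ∀ k : K, IsPerfectRing (R ⧸ Ideal.torsionOf R K k)) :
    DirectSum.IsInternal (primaryComponent (R := R) K) := by
  apply DirectSum.isInternal_submodule_of_iSupIndep_of_iSup_eq_top
  · intro 𝔪
    have hle : ⨆ 𝔫, ⨆ (_ : 𝔫 ≠ 𝔪), primaryComponent (R := R) K 𝔫 ≤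
        Submodule.torsion' R K 𝔪.asIdeal.primeCompl := by
      refine iSup₂_le fun 𝔫 hne x hx => ?_
      obtain ⟨n, hn, hn'⟩ : ∃ n ∈ 𝔪.asIdeal, n ∉ 𝔫.asIdeal := by
        refine SetLike.not_le_iff_exists.1 fun h => hne ?_
        exact MaximalSpectrum.ext (𝔪.isMaximal.eq_of_le 𝔫.isMaximal.ne_top h).symm
      obtain ⟨r, hr⟩ := hx n hn'
      refine ⟨⟨1 - r * n, fun h => 𝔪.isMaximal.ne_top ((Ideal.eq_top_iff_one _).2 ?_)⟩, ?_⟩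
      · simpa using add_mem h (𝔪.asIdeal.mul_mem_left r hn)
      · change (1 - r * n) • x = 0
        rw [sub_smul, one_smul, mul_smul, hr, sub_self]
    rw [Submodule.disjoint_def]
    intro x hx hx'
    obtain ⟨⟨n, hn⟩, hnx : n • x = 0⟩ := hle hx'
    obtain ⟨r, hr⟩ := hx n hn
    rw [← hr, hnx, smul_zero]
  · rw [eq_top_iff]
    intro k _
    by_contra hk
    have hne : Submodule.comap (LinearMap.toSpanSingleton R K k)
        (⨆ 𝔪, primaryComponent (R := R) K 𝔪) ≠ ⊤ := by
      intro h
      apply hk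
      simpa using (show (1 : R) ∈ Submodule.comap (LinearMap.toSpanSingleton R K k)
        (⨆ 𝔪, primaryComponent (R := R) K 𝔪) by rw [h]; trivial)
    obtain ⟨𝔪, h𝔪, hle⟩ := Ideal.exists_le_maximal _ hne
    obtain ⟨_, ⟨d, hd, rfl⟩, hdvd⟩ := exists_mem_forall_dvd_of_isPerfectRing (hK k)
      (𝔪.primeCompl.map (Ideal.Quotient.mk (Ideal.torsionOf R K k)))
    refine hd (hle (Submodule.mem_iSup_of_mem ⟨𝔪, h𝔪⟩ ?_))
    intro n hn
    obtain ⟨s, hs⟩ := hdvd _ ⟨n * d, mul_mem hn hd, rfl⟩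
    obtain ⟨r, rfl⟩ := Ideal.Quotient.mk_surjective s
    refine ⟨r, ?_⟩
    change Ideal.Quotient.mk _ d = Ideal.Quotient.mk _ (n * d) * Ideal.Quotient.mk _ r at hs
    rw [← map_mul, Ideal.Quotient.eq, Ideal.mem_torsionOf_iff] at hs
    rw [LinearMap.toSpanSingleton_apply]
    linear_combination (norm := module) -hs

/-- A finitely generated ideal `J ≤ 𝔪` acts nilpotently on each element of the `𝔪`-primary
component. -/
theorem exists_pow_smul_eq_zero_of_mem_primaryComponent {R : Type u} [CommRing R]
    {K : Type u} [AddCommGroup K] [Module R K] {𝔪 : MaximalSpectrum R} {k : K}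
    (hperf : IsPerfectRing (R ⧸ Ideal.torsionOf R K k)) (hk : k ∈ primaryComponent K 𝔪)
    {J : Ideal R} (hJ : J ≤ 𝔪.asIdeal) (hfg : J.FG) : ∃ n, ∀ r ∈ J ^ n, r • k = 0 := by
  obtain ⟨n, hn⟩ : ∃ n, J ^ n ≤ Ideal.torsionOf R K k := by
    refine Ideal.exists_pow_le_of_le_radical_of_fg (fun a ha => ?_) hfg
    obtain ⟨_, ⟨N, rfl⟩, hdvd⟩ := exists_mem_forall_dvd_of_isPerfectRing hperf
      (Submonoid.powers (Ideal.Quotient.mk (Ideal.torsionOf R K k) a))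
    obtain ⟨s, hs⟩ := hdvd _ ⟨N + 1, rfl⟩
    obtain ⟨s, rfl⟩ := Ideal.Quotient.mk_surjective s
    dsimp only at hs
    rw [← map_pow, ← map_pow, ← map_mul, Ideal.Quotient.eq, Ideal.mem_torsionOf_iff] at hs
    obtain ⟨r, hr⟩ := hk (1 - a * s) fun h => 𝔪.isMaximal.ne_top <|
      (Ideal.eq_top_iff_one _).2 <| by simpa using add_mem h (𝔪.asIdeal.mul_mem_right s (hJ ha))
    refine ⟨N, ?_⟩
    rw [Ideal.mem_torsionOf_iff, ← hr]
    linear_combination (norm := (rw [pow_succ]; module)) r • hs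
  exact ⟨n, fun r hr => hn hr⟩

/-- Linear maps on the summands of an internal direct sum glue. -/
theorem exists_linearMap_of_isInternal {R ι : Type*} [CommRing R] [DecidableEq ι] {K H : Type*}
    [AddCommGroup K] [Module R K] [AddCommGroup H] [Module R H] {A : ι → Submodule R K}
    (hA : DirectSum.IsInternal A) (b : ∀ m, A m →ₗ[R] H) :
    ∃ B : K →ₗ[R] H, ∀ m (x : A m), B x = b m x := by
  let e := LinearEquiv.ofBijective (DirectSum.coeLinearMap A) hA
  refine ⟨DirectSum.toModule R ι H b ∘ₗ e.symm.toLinearMap, fun m x => ?_⟩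
  have hx : e.symm x = DirectSum.lof R ι (fun m => A m) m x :=
    e.symm_apply_eq.2 (DirectSum.coeLinearMap_lof A m x).symm
  rw [LinearMap.comp_apply, LinearEquiv.coe_coe, hx, DirectSum.toModule_lof]

namespace GabrielTopology

variable {R : Type u} [CommRing R] {G : GabrielTopology R}

/-- For every maximal ideal `𝔪` some `J ∈ G` acts locally nilpotently on the `𝔪`-primary component
of a `G`-torsion module. -/
theorem exists_mem_pow_smul_eq_zero (hfg : G.FinitelyGenerated)
    (hRJ : ∀ J ∈ G.sets, IsPerfectRing (R ⧸ J)) {K : Type u} [AddCommGroup K] [Module R K]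
    (hK : G.IsTorsion K) (𝔪 : MaximalSpectrum R) :
    ∃ J ∈ G.sets, ∀ k ∈ primaryComponent K 𝔪, ∃ n, ∀ r ∈ J ^ n, r • k = 0 := by
  by_cases h𝔪 : 𝔪.asIdeal ∈ G.sets
  · obtain ⟨J, hJ, hle, hJfg⟩ := hfg _ h𝔪
    exact ⟨J, hJ, fun k hk =>
      exists_pow_smul_eq_zero_of_mem_primaryComponent (hRJ _ (hK k)) hk hle hJfg⟩
  · refine ⟨⊤, G.top_mem, fun k hk => ⟨0, fun r _ => ?_⟩⟩
    obtain ⟨n, hn, hn'⟩ := SetLike.not_le_iff_exists.1 fun h => h𝔪 (G.mem_of_le (hK k) h)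
    obtain ⟨s, hs⟩ := hk n hn'
    rw [← hs, (Ideal.mem_torsionOf_iff _ _).1 hn, smul_zero, smul_zero]

/-- Global solution of the lifting problem of `exists_pairing_lift_of_pow` for a `G`-torsion
module `K`. -/
theorem exists_pairing_lift (hfg : G.FinitelyGenerated)
    (hpow : ∀ J ∈ G.sets, ∀ n : ℕ, J ^ n ∈ G.sets)
    (hRJ : ∀ J ∈ G.sets, IsPerfectRing (R ⧸ J)) {E F K T T' : Type u}
    [AddCommGroup E] [Module R E] [AddCommGroup F] [Module R F] [Module.Flat R F]
    [AddCommGroup K] [Module R K] [AddCommGroup T] [Module R T] [AddCommGroup T'] [Module R T']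
    (hK : G.IsTorsion K) (j : E →ₗ[R] F)
    (hdiv : ∀ J ∈ G.sets, LinearMap.range j ⊔ J • ⊤ = ⊤)
    (act : E →ₗ[R] K →ₗ[R] T) (p : T →ₗ[R] T') (α : K →ₗ[R] F →ₗ[R] T')
    (hα : ∀ c k, p (act c k) = α k (j c)) :
    ∃ b : K →ₗ[R] F →ₗ[R] T, ∀ k f, p (b k f) = α k f := by
  classical
  have hloc (𝔪 : MaximalSpectrum R) : ∃ b : primaryComponent K 𝔪 →ₗ[R] F →ₗ[R] T,
      ∀ k f, p (b k f) = α k f := by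
    obtain ⟨J, hJ, h⟩ := exists_mem_pow_smul_eq_zero hfg hRJ hK 𝔪
    exact exists_pairing_lift_of_pow j J (fun n => hRJ _ (hpow J hJ n))
      (fun n => hdiv _ (hpow J hJ n)) act p α hα _ h
  choose b hb using hloc
  have hInt := isInternal_primaryComponent fun k => hRJ _ (hK k)
  obtain ⟨B, hB⟩ := exists_linearMap_of_isInternal hInt b
  refine ⟨B, fun k f => ?_⟩
  have hk : k ∈ ⨆ 𝔪, primaryComponent (R := R) K 𝔪 := by
    rw [hInt.submodule_iSup_eq_top]
    trivial
  induction hk using Submodule.iSup_induction' with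
  | mem 𝔪 x hx => rw [hB 𝔪 ⟨x, hx⟩, hb]
  | zero => simp
  | add x y _ _ hx hy => simp only [map_add, LinearMap.add_apply, hx, hy]

variable {U : Type u} [CommRing U] [Algebra R U]

theorem IsPerfectLocalization.pow_mem (hperf : G.IsPerfectLocalization U) {J : Ideal R}
    (hJ : J ∈ G.sets) (n : ℕ) : J ^ n ∈ G.sets := by
  induction n with
  | zero => simpa using G.top_mem
  | succ n ih =>
    rw [hperf.2.2] at hJ ih ⊢
    rw [pow_succ, Submodule.mul_smul, hJ, ih]

open TensorProduct in
/-- The cokernel of a perfect localisation is torsion. -/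
theorem IsPerfectLocalization.isTorsion_cokerAlg (hperf : G.IsPerfectLocalization U) :
    G.IsTorsion (cokerAlg R U) := by
  intro k
  obtain ⟨u, rfl⟩ := Submodule.mkQ_surjective _ k
  set k := Submodule.mkQ (LinearMap.range (Algebra.linearMap R U)) u
  have := hperf.1
  have hepi : (1 : U) ⊗ₜ[R] u = u ⊗ₜ[R] 1 := by
    refine (RingHom.congr_fun (hperf.2.1 (U ⊗[R] U)
      (Algebra.TensorProduct.includeLeft : U →ₐ[R] U ⊗[R] U).toRingHom
      (Algebra.TensorProduct.includeRight : U →ₐ[R] U ⊗[R] U).toRingHom ?_) u).symm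
    ext r
    simp
  have hk : (1 : U) ⊗ₜ[R] k = 0 := by
    have h₁ : Submodule.mkQ (LinearMap.range (Algebra.linearMap R U)) 1 = 0 :=
      (Submodule.Quotient.mk_eq_zero _).2 ⟨1, by simp⟩
    rw [← LinearMap.lTensor_tmul, hepi, LinearMap.lTensor_tmul, h₁, tmul_zero]
  let i : (R ⧸ Ideal.torsionOf R _ k) →ₗ[R] cokerAlg R U :=
    Submodule.liftQ _ (LinearMap.toSpanSingleton R _ k) le_rfl
  have hi : Function.Injective i := LinearMap.ker_eq_bot.1 (Submodule.ker_liftQ_eq_bot _ _ _ le_rfl)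
  have h1 : (1 : U) ⊗ₜ[R] (1 : R ⧸ Ideal.torsionOf R _ k) = 0 := by
    apply Module.Flat.lTensor_preserves_injective_linearMap (M := U) i hi
    rw [LinearMap.lTensor_tmul, map_zero]
    exact (congrArg _ (one_smul R k)).trans hk
  have h1mem : (1 : U) ∈ Ideal.torsionOf R _ k • (⊤ : Submodule R U) := by
    have := congrArg (tensorQuotEquivQuotSMul U (Ideal.torsionOf R _ k)) h1
    rw [map_zero] at this
    rw [← Submodule.Quotient.mk_eq_zero]
    refine Eq.trans ?_ this
    exact ((tensorQuotEquivQuotSMul_tmul_mk _ _ 1).trans (by rw [one_smul])).symm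
  rw [hperf.2.2, eq_top_iff]
  intro v _
  have hv : LinearMap.mulLeft R v 1 ∈
      (Ideal.torsionOf R _ k • (⊤ : Submodule R U)).map (LinearMap.mulLeft R v) :=
    Submodule.mem_map_of_mem h1mem
  rw [Submodule.map_smul'', LinearMap.mulLeft_apply, mul_one] at hv
  exact Submodule.smul_mono le_rfl le_top hv

theorem IsTorsion.finsupp {K : Type u} [AddCommGroup K] [Module R K] (hK : G.IsTorsion K)
    (ι : Type u) : G.IsTorsion (ι →₀ K) := by
  intro x
  induction x using Finsupp.induction_linear with
  | zero => simpa using G.top_mem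
  | add x y hx hy =>
    refine G.mem_of_le (G.inf_mem hx hy) fun r hr => ?_
    rw [Ideal.mem_torsionOf_iff, smul_add, (Ideal.mem_torsionOf_iff _ _).1 hr.1,
      (Ideal.mem_torsionOf_iff _ _).1 hr.2, add_zero]
  | single a k =>
    refine G.mem_of_le (hK k) fun r hr => ?_
    rw [Ideal.mem_torsionOf_iff, Finsupp.smul_single, (Ideal.mem_torsionOf_iff _ _).1 hr,
      Finsupp.single_zero]

theorem IsDivisible.of_surjective {M N : Type u} [AddCommGroup M] [Module R M] [AddCommGroup N]
    [Module R N] (hM : G.IsDivisible M) (f : M →ₗ[R] N) (hf : Function.Surjective f) :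
    G.IsDivisible N := by
  intro J hJ
  rw [← LinearMap.range_eq_top.2 hf, ← Submodule.map_top, ← Submodule.map_smul'', hM J hJ]

theorem IsDivisible.finsupp {M : Type u} [AddCommGroup M] [Module R M] (hM : G.IsDivisible M)
    (ι : Type u) : G.IsDivisible (ι →₀ M) := by
  intro J hJ
  rw [eq_top_iff]
  intro x _
  induction x using Finsupp.induction_linear with
  | zero => exact zero_mem _
  | add x y hx hy => exact add_mem (hx trivial) (hy trivial)
  | single a m =>
    have hm : Finsupp.lsingle a m ∈ (J • (⊤ : Submodule R M)).map (Finsupp.lsingle a) :=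
      Submodule.mem_map_of_mem (by rw [hM J hJ]; trivial)
    rw [Submodule.map_smul''] at hm
    exact Submodule.smul_mono le_rfl le_top hm

/-- Pure submodules of `G`-divisible modules are `G`-divisible. -/
theorem IsDivisible.of_pure {A T : Type u} [AddCommGroup A] [Module R A] [AddCommGroup T]
    [Module R T] (hT : G.IsDivisible T) (i : A →ₗ[R] T)
    (hi : ∀ (M : Type u) [AddCommGroup M] [Module R M],
      Function.Injective (LinearMap.rTensor M i)) : G.IsDivisible A := by
  intro J hJ
  have h₁ : Subsingleton (T ⧸ (J • ⊤ : Submodule R T)) :=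
    Submodule.Quotient.subsingleton_iff.2 (hT J hJ)
  have h₂ := (TensorProduct.tensorQuotEquivQuotSMul T J).injective.subsingleton
  have h₃ := (hi (R ⧸ J)).subsingleton
  exact Submodule.Quotient.subsingleton_iff.1
    (TensorProduct.tensorQuotEquivQuotSMul A J).symm.injective.subsingleton

/-- A pure submodule of a direct sum of copies of `U / R` is a direct summand. -/
theorem IsPerfectLocalization.exists_retraction_of_pure (hfg : G.FinitelyGenerated)
    (hinj : Function.Injective (algebraMap R U)) (hperf : G.IsPerfectLocalization U)
    (hRJ : ∀ J ∈ G.sets, IsPerfectRing (R ⧸ J)) {A ι : Type u} [AddCommGroup A] [Module R A]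
    (i : A →ₗ[R] ι →₀ cokerAlg R U) (hi_inj : Function.Injective i)
    (hi : ∀ (M : Type u) [AddCommGroup M] [Module R M],
      Function.Injective (LinearMap.rTensor M i)) :
    ∃ r : (ι →₀ cokerAlg R U) →ₗ[R] A, r ∘ₗ i = LinearMap.id := by
  have := hperf.1
  have hdivU : G.IsDivisible U := fun J hJ => (hperf.2.2 J).1 hJ
  set π : U →ₗ[R] cokerAlg R U := Submodule.mkQ _
  have hπ : Function.Surjective π := Submodule.mkQ_surjective _
  have π_algebraMap (r : R) : π (algebraMap R U r) = 0 :=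
    (Submodule.Quotient.mk_eq_zero _).2 ⟨r, rfl⟩
  let q : (ι →₀ U) →ₗ[R] (ι →₀ cokerAlg R U) := Finsupp.mapRange.linearMap π
  have hq : Function.Surjective q := Finsupp.mapRange_surjective _ (map_zero π) hπ
  let j : (ι →₀ R) →ₗ[R] (ι →₀ U) := Finsupp.mapRange.linearMap (Algebra.linearMap R U)
  have hj : Function.Injective j := Finsupp.mapRange_injective _ (map_zero _) hinj
  have hjq : LinearMap.range j = LinearMap.ker q := by
    rw [Finsupp.range_mapRange_linearMap _ (LinearMap.ker_eq_bot.2 hinj), Finsupp.ker_mapRange, Submodule.ker_mkQ]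
  set X := LinearMap.range i
  set F := X.comap q
  have : Module.Flat R (ι →₀ U) := by
    classical exact .of_linearEquiv (finsuppLEquivDirectSum R U ι)
  have hF : Module.Flat R F := flat_comap_range_of_pure i hi j q hj hq hjq
  have qj (c : ι →₀ R) : q (j c) = 0 := by
    rw [← LinearMap.mem_ker, ← hjq]
    exact ⟨c, rfl⟩
  let jF : (ι →₀ R) →ₗ[R] F := j.codRestrict F fun c => by
    change q (j c) ∈ X
    rw [qj]
    exact zero_mem _
  have hdiv (J) (hJ : J ∈ G.sets) : LinearMap.range jF ⊔ J • ⊤ = ⊤ := by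
    have hA : G.IsDivisible A :=
      ((hdivU.of_surjective π hπ).finsupp ι).of_pure i hi
    let s : F →ₗ[R] X := q.restrict fun _ hx => hx
    have hs : Function.Surjective s := fun x => by
      obtain ⟨v, hv⟩ := hq x
      exact ⟨⟨v, by change q v ∈ X; rw [hv]; exact x.2⟩, Subtype.ext hv⟩
    have hker : LinearMap.ker s ≤ LinearMap.range jF := fun f hf => by
      have : (f : ι →₀ U) ∈ LinearMap.range j := by
        rw [hjq]
        exact congrArg Subtype.val hf
      obtain ⟨c, hc⟩ := this
      exact ⟨c, Subtype.ext hc⟩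
    have hX : G.IsDivisible X := hA.of_surjective i.rangeRestrict i.surjective_rangeRestrict
    have h := Submodule.comap_map_eq (M := F) (M₂ := X) s (J • ⊤)
    rw [Submodule.map_smul'', Submodule.map_top, LinearMap.range_eq_top.2 hs, hX J hJ,
      Submodule.comap_top] at h
    exact top_unique (h.le.trans ((sup_comm _ _).le.trans (sup_le_sup_right hker _)))
  let act : (ι →₀ R) →ₗ[R] cokerAlg R U →ₗ[R] (ι →₀ cokerAlg R U) :=
    LinearMap.mk₂ R (fun c k => Finsupp.mapRange.linearMap (LinearMap.toSpanSingleton R _ k) c)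
      (fun _ _ _ => map_add _ _ _) (fun _ _ _ => map_smul _ _ _)
      (fun _ _ _ => by ext; simp) (fun _ _ _ => by ext; simp [smul_smul, mul_comm])
  have act_single (a : ι) (k : cokerAlg R U) : act (Finsupp.single a 1) k = Finsupp.single a k := by
    simp [act]
  have q_smul_j (u : U) (c : ι →₀ R) : q (u • j c) = act c (π u) := by
    ext a
    simp [q, j, act, ← map_smul, Algebra.smul_def, mul_comm]
  let α₀ : U →ₗ[R] F →ₗ[R] ((ι →₀ cokerAlg R U) ⧸ X) :=
    LinearMap.mk₂ R (fun u f => X.mkQ (q (u • (f : ι →₀ U))))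
      (fun _ _ _ => by rw [add_smul, map_add, map_add])
      (fun _ _ _ => by rw [smul_assoc, map_smul, map_smul])
      (fun _ _ _ => by rw [Submodule.coe_add, smul_add, map_add, map_add])
      (fun _ _ _ => by rw [Submodule.coe_smul, smul_comm, map_smul, map_smul])
  let α : cokerAlg R U →ₗ[R] F →ₗ[R] ((ι →₀ cokerAlg R U) ⧸ X) :=
    Submodule.liftQ _ α₀ <| by
      rintro _ ⟨r, rfl⟩
      ext f
      refine (Submodule.Quotient.mk_eq_zero _).2 ?_
      rw [Algebra.linearMap_apply, algebraMap_smul, map_smul]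
      exact X.smul_mem r f.2
  have hα (c k) : X.mkQ (act c k) = α k (jF c) := by
    obtain ⟨u, rfl⟩ := hπ k
    rw [← q_smul_j]
    rfl
  obtain ⟨b, hb⟩ := exists_pairing_lift (F := F) (T' := (ι →₀ cokerAlg R U) ⧸ X) hfg
    (fun J hJ => hperf.pow_mem hJ) hRJ hperf.isTorsion_cokerAlg jF hdiv act X.mkQ α hα
  let Φ : (ι →₀ cokerAlg R U) →ₗ[R] (ι →₀ cokerAlg R U) :=
    Finsupp.lsum R fun a => b.flip (jF (Finsupp.single a 1))
  have Φ_single (a : ι) (k) : Φ (Finsupp.single a k) = b k (jF (Finsupp.single a 1)) := by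
    simp [Φ]
  have hΦX (x) : x - Φ x ∈ X := by
    rw [← Submodule.Quotient.mk_eq_zero, ← Submodule.mkQ_apply, map_sub, sub_eq_zero]
    revert x
    refine LinearMap.congr_fun (f := X.mkQ) (g := X.mkQ ∘ₗ Φ) (Finsupp.lhom_ext fun a k => ?_)
    change X.mkQ (Finsupp.single a k) = X.mkQ (Φ (Finsupp.single a k))
    rw [Φ_single, hb, ← hα, act_single]
  have Φ_act (c k) : Φ (act c k) = b k (jF c) := by
    refine LinearMap.congr_fun (f := Φ ∘ₗ act.flip k) (g := b k ∘ₗ jF) ?_ c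
    ext a : 2
    simp only [LinearMap.comp_apply, LinearMap.flip_apply, Finsupp.lsingle_apply]
    rw [act_single, Φ_single]
  have Φ_zero (f : F) : Φ (q f) = 0 := by
    let D : U →ₗ[R] (ι →₀ cokerAlg R U) :=
      Φ ∘ₗ q ∘ₗ (LinearMap.toSpanSingleton U (ι →₀ U) f).restrictScalars R - b.flip f ∘ₗ π
    have hD (u : U) : D u = Φ (q (u • (f : ι →₀ U))) - b (π u) f := rfl
    have hI := (hperf.isTorsion_cokerAlg.finsupp ι) (q f)
    have hD0 : (Ideal.torsionOf R _ (q f) • ⊤ : Submodule R U) ≤ LinearMap.ker D := by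
      rw [Submodule.smul_le]
      intro r hr u _
      rw [Ideal.mem_torsionOf_iff, ← map_smul, ← LinearMap.mem_ker, ← hjq] at hr
      obtain ⟨c, hc⟩ := hr
      have hc' : jF c = r • f := Subtype.ext hc
      rw [LinearMap.mem_ker, hD, smul_assoc, smul_comm, ← hc, q_smul_j, Φ_act, hc', map_smul,
        map_smul, map_smul, LinearMap.smul_apply, sub_self]
    rw [(hperf.2.2 _).1 hI] at hD0
    have h1 : D 1 = 0 := hD0 trivial
    rwa [hD, one_smul, ← map_one (algebraMap R U), π_algebraMap, map_zero, LinearMap.zero_apply,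
      sub_zero] at h1
  refine ⟨(LinearEquiv.ofInjective i hi_inj).symm.toLinearMap ∘ₗ
    (LinearMap.id - Φ).codRestrict X hΦX, ?_⟩
  ext a
  simp only [LinearMap.comp_apply, LinearEquiv.coe_coe, LinearMap.id_apply]
  rw [LinearEquiv.symm_apply_eq]
  apply Subtype.ext
  obtain ⟨v, hv⟩ := hq (i a)
  have h := Φ_zero ⟨v, by change q v ∈ X; rw [hv]; exact ⟨a, rfl⟩⟩
  change i a - Φ (i a) = i a
  rw [← hv, h, sub_zero]

end GabrielTopology

theorem stmt9 (R : Type u) [CommRing R] (G : GabrielTopology R)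
    (hfaith : G.Faithful) (hfg : G.FinitelyGenerated)
    (U : Type u) [CommRing U] [Algebra R U]
    (hinj : Function.Injective (algebraMap R U))
    (hperf : G.IsPerfectLocalization U)
    (hRJ : ∀ J ∈ G.sets, IsPerfectRing (R ⧸ J)) :
    SigmaPureSplit R (cokerAlg R U) := by
  intro A B _ _ _ _ i hi_inj hi ⟨ι, s, r, hrs⟩
  have hs_left : Function.LeftInverse r s := LinearMap.congr_fun hrs
  have hs (M : Type u) [AddCommGroup M] [Module R M] :
      Function.LeftInverse (r.rTensor M) (s.rTensor M) := by
    refine LinearMap.congr_fun (f := r.rTensor M ∘ₗ s.rTensor M) (g := LinearMap.id) ?_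
    rw [← LinearMap.rTensor_comp, hrs, LinearMap.rTensor_id]
  obtain ⟨t, ht⟩ := hperf.exists_retraction_of_pure hfg hinj hRJ (s ∘ₗ i)
    (hs_left.injective.comp hi_inj) fun M _ _ => by
      rw [LinearMap.rTensor_comp]
      exact (hs M).injective.comp (hi M)
  exact ⟨t ∘ₗ s, ht⟩
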